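/- Let α = 1 and σ ∈ {−1, +1}. For every u₀ : ℤ → ℂ with ‖u₀‖_{L²} < ∞ one has sup_{τ ∈ [−1,1]} ‖Φ_τ(u₀) − Φ_τ^N(Π_N u₀)‖_{L²} → 0 as N → ∞. Moreover, if K is a compact subset of ℓ²(ℤ, ℂ), then sup_{u₀ ∈ K} sup_{τ ∈ [−1,1]} ‖Φ_τ(u₀) − Φ_τ^N(Π_N u₀)‖_{L²} → 0 as N → ∞. -/

import Mathlib

open scoped BigOperators ENNReal ComplexConjugate Classical
open Filter Set MeasureTheory ComplexConjugate

noncomputable section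

/-- `ℝ≥0∞`-valued `H^s` norm of a sequence of Fourier coefficients. -/
def hsE (s : ℝ) (u : ℤ → ℂ) : ℝ≥0∞ :=
  (∑' n : ℤ, ENNReal.ofReal (1 + |(n : ℝ)| ^ (2 * s)) * (‖u n‖₊ : ℝ≥0∞) ^ 2) ^ ((1:ℝ)/2)

/-- `ℝ≥0∞`-valued `FL^{0,1}` norm. -/
def flE (u : ℤ → ℂ) : ℝ≥0∞ := ∑' n : ℤ, (‖u n‖₊ : ℝ≥0∞)

/-- real-valued `H^s` norm. -/
def hsR (s : ℝ) (u : ℤ → ℂ) : ℝ :=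
  Real.sqrt (∑' n : ℤ, (1 + |(n : ℝ)| ^ (2 * s)) * ‖u n‖ ^ 2)

/-- real-valued `FL^{0,1}` norm. -/
def flR (u : ℤ → ℂ) : ℝ := ∑' n : ℤ, ‖u n‖

/-- The condition `|j| ≤ N` for `N ∈ ℕ ∪ {∞}`. -/
def inBall (N : ℕ∞) (j : ℤ) : Prop := (j.natAbs : ℕ∞) ≤ N

/-- The resonance function `Φ_α`. -/
def res (α : ℝ) (j₁ j₂ j₃ : ℤ) : ℝ :=
  |(j₁ : ℝ)| ^ (2 * α) + |(j₂ : ℝ)| ^ (2 * α) - |(j₃ : ℝ)| ^ (2 * α)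
    - |((j₁ + j₂ - j₃ : ℤ) : ℝ)| ^ (2 * α)

/-- The (truncated) Birkhoff vector field `X_N`. -/
def XB (α σ : ℝ) (N : ℕ∞) (u : ℤ → ℂ) : ℤ → ℂ := fun n =>
  if inBall N n then
    ∑' p : ℤ × ℤ,
      (if inBall N p.1 ∧ inBall N p.2 ∧ inBall N (p.1 + p.2 - n) ∧
          res α p.1 p.2 (p.1 + p.2 - n) ≠ 0 then
        ((-σ / res α p.1 p.2 (p.1 + p.2 - n) : ℝ) : ℂ) *
          (u p.1 * u p.2 * conj (u (p.1 + p.2 - n)))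
      else 0)
  else 0

/-- Truncation `Π_N`. -/
def trunc (N : ℕ) (u : ℤ → ℂ) : ℤ → ℂ := fun n => if n.natAbs ≤ N then u n else 0

/-- Derivative of a curve at `t`, in the `H^s` norm. -/
def HasHsDerivAt (s : ℝ) (u : ℝ → ℤ → ℂ) (d : ℤ → ℂ) (t : ℝ) : Prop :=
  Tendsto (fun h : ℝ => hsE s (fun n => (u (t + h) n - u t n) / (h : ℂ) - d n))
    (nhdsWithin 0 {(0 : ℝ)}ᶜ) (nhds 0)

/-- Derivative of a curve at `t` within a set `A` of times, in the `H^s` norm. -/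
def HasHsDerivWithinAt (s : ℝ) (u : ℝ → ℤ → ℂ) (d : ℤ → ℂ) (A : Set ℝ) (t : ℝ) : Prop :=
  Tendsto (fun h : ℝ => hsE s (fun n => (u (t + h) n - u t n) / (h : ℂ) - d n))
    (nhdsWithin 0 {h : ℝ | t + h ∈ A ∧ h ≠ 0}) (nhds 0)

/-- Continuity of a curve in the `H^s` norm. -/
def ContHs (s : ℝ) (D : ℝ → ℤ → ℂ) : Prop :=
  ∀ t : ℝ, Tendsto (fun t' => hsE s (fun n => D t' n - D t n)) (nhds t) (nhds 0)

/-- Continuity of a curve in the `H^s` norm, on a set of times. -/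
def ContHsOn (s : ℝ) (A : Set ℝ) (D : ℝ → ℤ → ℂ) : Prop :=
  ∀ t ∈ A, Tendsto (fun t' => hsE s (fun n => D t' n - D t n)) (nhdsWithin t A) (nhds 0)

/-- `u` is a global-in-time solution of `d/dt u = X_N(u)`, as a curve in `H^s`. -/
def IsSol (α σ : ℝ) (N : ℕ∞) (s : ℝ) (u : ℝ → ℤ → ℂ) : Prop :=
  ∀ t : ℝ, hsE s (u t) ≠ ⊤ ∧ HasHsDerivAt s u (XB α σ N (u t)) t

/-- `u` solves `d/dt u = X_N(u)` on the set of times `A`, as a curve in `H^s`. -/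
def IsSolOn (α σ : ℝ) (N : ℕ∞) (s : ℝ) (A : Set ℝ) (u : ℝ → ℤ → ℂ) : Prop :=
  ∀ t ∈ A, hsE s (u t) ≠ ⊤ ∧ HasHsDerivWithinAt s u (XB α σ N (u t)) A t

/-- `u` is a global-in-time continuously differentiable solution, as a curve in `H^s`. -/
def IsC1Sol (α σ : ℝ) (N : ℕ∞) (s : ℝ) (u : ℝ → ℤ → ℂ) : Prop :=
  IsSol α σ N s u ∧ ContHs s (fun t => XB α σ N (u t))

/-- `u` is a continuously differentiable solution on the set of times `A`. -/
def IsC1SolOn (α σ : ℝ) (N : ℕ∞) (s : ℝ) (A : Set ℝ) (u : ℝ → ℤ → ℂ) : Prop :=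
  IsSolOn α σ N s A u ∧ ContHsOn s A (fun t => XB α σ N (u t))

/-- integer modes in `[-N, N]`. -/
def Ifin (N : ℕ) : Finset ℤ := Finset.Icc (-(N:ℤ)) (N:ℤ)

/-- The quartic form `‖Π_N u‖⁴_{L⁴}`. -/
def qL4 (N : ℕ) (u : ℤ → ℂ) : ℝ :=
  (∑ j₁ ∈ Ifin N, ∑ j₂ ∈ Ifin N, ∑ j₃ ∈ Ifin N, ∑ j₄ ∈ Ifin N,
    if j₁ + j₂ = j₃ + j₄ then u j₁ * u j₂ * conj (u j₃) * conj (u j₄) else 0).re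

/-- `G_N(u)`, the derivative at `t = 0` of the energy along the truncated Birkhoff flow. -/
def GN (α σ : ℝ) (N : ℕ) (u : ℤ → ℂ) : ℝ :=
  -(σ/2) * qL4 N u + σ * (∑ j ∈ Ifin N, ‖u j‖^2)^2
  + 2 * σ * (∑ n₁ ∈ Ifin N, ∑ n₂ ∈ Ifin N, ∑ m₁ ∈ Ifin N, ∑ m₂ ∈ Ifin N,
      if n₁ + n₂ = m₁ + m₂ then
        XB α σ (N : ℕ∞) (trunc N u) n₁ * u n₂ * conj (u m₁) * conj (u m₂)
      else 0).re


section AbstractFlow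

open Metric NNReal

/-- A family of nonnegative-error quantities which tends to zero pointwise and is equi-Lipschitz
tends to zero uniformly on compact sets. -/
lemma IsCompact.eventually_forall_le_of_equiLipschitz {α β : Type*} [PseudoMetricSpace α]
    {K : Set α} (hK : IsCompact K) {B : Set β} {g : ℕ → α → β → ℝ} {C : ℝ} (hC : 0 < C)
    (hlip : ∀ N, ∀ x ∈ K, ∀ y ∈ K, ∀ b ∈ B, g N x b ≤ g N y b + C * dist x y)
    (hpt : ∀ x ∈ K, ∀ ε : ℝ, 0 < ε → ∀ᶠ N in atTop, ∀ b ∈ B, g N x b ≤ ε) {ε : ℝ} (hε : 0 < ε) :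
    ∀ᶠ N in atTop, ∀ x ∈ K, ∀ b ∈ B, g N x b ≤ ε := by
  obtain ⟨t, htK, htf, hcov⟩ := hK.finite_cover_balls (e := ε / 2 / C) (by positivity)
  have h : ∀ᶠ N in atTop, ∀ y ∈ t, ∀ b ∈ B, g N y b ≤ ε / 2 :=
    (eventually_all_finite htf).2 fun y hy => hpt y (htK hy) _ (half_pos hε)
  filter_upwards [h] with N hN x hx b hb
  obtain ⟨y, hy, hxy⟩ := mem_iUnion₂.1 (hcov hx)
  have h1 := hlip N x hx y (htK hy) b hb
  have h2 := hN y hy b hb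
  have h3 : dist x y * C < ε / 2 := (lt_div_iff₀ hC).1 (mem_ball.1 hxy)
  linarith

section Contractions

variable {E : Type*} [NormedAddCommGroup E] {X : E → E} {P : ℕ → E → E}

lemma LipschitzOnWith.comp_contraction {L : ℝ≥0} {R : ℝ}
    (hX : LipschitzOnWith L X (closedBall 0 R))
    (hPsub : ∀ N x y, P N (x - y) = P N x - P N y) (hPnorm : ∀ N x, ‖P N x‖ ≤ ‖x‖) (N : ℕ) :
    LipschitzOnWith L (fun x => P N (X (P N x))) (closedBall 0 R) := by
  refine LipschitzOnWith.of_dist_le_mul fun x hx y hy => ?_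
  have hP : ∀ z ∈ closedBall (0 : E) R, P N z ∈ closedBall (0 : E) R := fun z hz => by
    rw [mem_closedBall_zero_iff] at hz ⊢
    exact (hPnorm N z).trans hz
  have h1 := hX.dist_le_mul _ (hP x hx) _ (hP y hy)
  rw [dist_eq_norm, dist_eq_norm, ← hPsub] at h1
  rw [dist_eq_norm, dist_eq_norm, ← hPsub]
  exact (hPnorm _ _).trans (h1.trans (mul_le_mul_of_nonneg_left (hPnorm _ _) L.2))

lemma eventually_norm_sub_le_of_isCompact
    (hPsub : ∀ N x y, P N (x - y) = P N x - P N y) (hPnorm : ∀ N x, ‖P N x‖ ≤ ‖x‖)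
    (hPlim : ∀ x, Tendsto (fun N => ‖x - P N x‖) atTop (nhds 0)) {K : Set E} (hK : IsCompact K)
    {ε : ℝ} (hε : 0 < ε) : ∀ᶠ N in atTop, ∀ x ∈ K, ‖x - P N x‖ ≤ ε := by
  have h := hK.eventually_forall_le_of_equiLipschitz (B := (univ : Set Unit))
    (g := fun N x _ => ‖x - P N x‖) (C := 2) two_pos ?_ ?_ hε
  · filter_upwards [h] with N hN x hx using hN x hx () trivial
  · intro N x _ y _ _ _
    have h1 : x - P N x = (y - P N y) + ((x - y) - P N (x - y)) := by rw [hPsub]; abel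
    have h2 := norm_add_le (y - P N y) ((x - y) - P N (x - y))
    have h3 := norm_sub_le (x - y) (P N (x - y))
    have h4 := hPnorm N (x - y)
    rw [← h1] at h2
    rw [dist_eq_norm]
    linarith
  · intro x _ ε hε
    filter_upwards [(hPlim x).eventually_le_const hε] with N hN _ _ using hN

end Contractions

variable {E : Type*} [NormedAddCommGroup E] [InnerProductSpace ℂ E] {X : E → E} {P : ℕ → E → E}

/-- `u` is a trajectory of the vector field `Y`: its difference quotients, formed with complex
scalars, converge to `Y (u t)`. -/
def IsTrajectory (Y : E → E) (u : ℝ → E) : Prop :=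
  ∀ t : ℝ, Tendsto (fun h : ℝ => ‖((h : ℂ)⁻¹) • (u (t + h) - u t) - Y (u t)‖)
    (nhdsWithin 0 {(0 : ℝ)}ᶜ) (nhds 0)

lemma IsTrajectory.hasDerivAt {Y : E → E} {u : ℝ → E} (hu : IsTrajectory Y u) (t : ℝ) :
    HasDerivAt u (Y (u t)) t := by
  rw [hasDerivAt_iff_tendsto_slope_zero, tendsto_iff_norm_sub_tendsto_zero]
  refine (hu t).congr fun h => ?_
  rw [← Complex.coe_smul, Complex.ofReal_inv]

lemma IsTrajectory.comp_neg {Y : E → E} {u : ℝ → E} (hu : IsTrajectory Y u) :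
    IsTrajectory (fun x => -Y x) (fun t => u (-t)) := by
  intro t
  have hneg : Tendsto (fun h : ℝ => -h) (nhdsWithin 0 {(0 : ℝ)}ᶜ) (nhdsWithin 0 {(0 : ℝ)}ᶜ) := by
    refine tendsto_nhdsWithin_iff.2 ⟨?_, ?_⟩
    · exact (Continuous.tendsto' continuous_neg 0 0 neg_zero).mono_left nhdsWithin_le_nhds
    · filter_upwards [self_mem_nhdsWithin] with h hh
      simpa using hh
  refine ((hu (-t)).comp hneg).congr fun h => ?_
  simp only [Function.comp_apply, Complex.ofReal_neg, inv_neg, neg_smul]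
  rw [← norm_neg, neg_add (t) h]
  congr 1
  abel

lemma IsTrajectory.norm_eq {Y : E → E} {u : ℝ → E} (hu : IsTrajectory Y u)
    (hY : ∀ x, (inner ℂ x (Y x)).re = 0) (t : ℝ) : ‖u t‖ = ‖u 0‖ := by
  let : InnerProductSpace ℝ E := InnerProductSpace.rclikeToReal ℂ E
  have hd : ∀ t, HasDerivAt (fun t => ‖u t‖ ^ 2) 0 t := fun t => by
    have h : HasDerivAt (fun t => ‖u t‖ ^ 2) (2 * inner ℝ (u t) (Y (u t))) t :=
      HasDerivAt.norm_sq (F := E) (hu.hasDerivAt t)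
    have h0 : inner ℝ (u t) (Y (u t)) = 0 := hY (u t)
    rwa [h0, mul_zero] at h
  have hconst := is_const_of_deriv_eq_zero (fun t => (hd t).differentiableAt)
    (fun t => (hd t).deriv) t 0
  exact (sq_eq_sq₀ (norm_nonneg _) (norm_nonneg _)).1 hconst

lemma dist_le_exp_of_approx_trajectory {Y : E → E} {R : ℝ} {L : ℝ≥0} (hL : 1 ≤ L)
    (hY : LipschitzOnWith L Y (closedBall 0 R)) {f g f' : ℝ → E} {δ ε : ℝ} (hδ : 0 ≤ δ)
    (hε : 0 ≤ ε) (hf : ∀ t, HasDerivAt f (f' t) t)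
    (hf' : ∀ t ∈ Icc (0 : ℝ) 1, ‖f' t - Y (f t)‖ ≤ ε) (hfR : ∀ t, ‖f t‖ ≤ R)
    (hg : ∀ t, HasDerivAt g (Y (g t)) t) (hgR : ∀ t, ‖g t‖ ≤ R)
    (h0 : ‖f 0 - g 0‖ ≤ δ) {t : ℝ} (ht : t ∈ Icc (0 : ℝ) 1) :
    ‖f t - g t‖ ≤ (δ + ε) * Real.exp L := by
  have h := dist_le_of_approx_trajectories_ODE_of_mem (v := fun _ => Y)
    (s := fun _ => closedBall 0 R) (K := L) (a := 0) (b := 1) (εf := ε) (εg := 0) (δ := δ)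
    (fun _ _ => hY) (fun s _ => (hf s).continuousAt.continuousWithinAt)
    (fun s _ => (hf s).hasDerivWithinAt)
    (fun s hs => by simpa [dist_eq_norm] using hf' s ⟨hs.1, hs.2.le⟩)
    (fun s _ => by simpa using hfR s)
    (fun s _ => (hg s).continuousAt.continuousWithinAt) (fun s _ => (hg s).hasDerivWithinAt)
    (fun s _ => by simp) (fun s _ => by simpa using hgR s)
    (by simpa [dist_eq_norm] using h0) t ht
  have hL' : (1 : ℝ) ≤ L := by exact_mod_cast hL
  have hmono := gronwallBound_mono hδ hε (K := L) (by positivity) ht.2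
  rw [sub_zero, add_zero, dist_eq_norm] at h
  refine h.trans (hmono.trans ?_)
  rw [gronwallBound_of_K_ne_0 (by positivity)]
  have h1 : ε / L ≤ ε := div_le_self hε hL'
  have h2 : (0 : ℝ) ≤ Real.exp L - 1 := by
    have := Real.one_le_exp (show (0 : ℝ) ≤ L by positivity)
    linarith
  have h3 := mul_le_mul_of_nonneg_right h1 h2
  simp only [mul_one]
  nlinarith

/-- Galerkin approximations `P N ∘ X ∘ P N` of a norm-preserving, locally Lipschitz vector field
`X` converge to the flow of `X` on `[0, 1]`, uniformly over compact sets of initial data. -/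
theorem eventually_norm_galerkin_sub_le_of_mem_Icc
    (hX : ∀ R : ℝ, ∃ L : ℝ≥0, 1 ≤ L ∧ LipschitzOnWith L X (closedBall 0 R))
    (hXinner : ∀ x, (inner ℂ x (X x)).re = 0)
    (hPsub : ∀ N x y, P N (x - y) = P N x - P N y) (hPnorm : ∀ N x, ‖P N x‖ ≤ ‖x‖)
    (hPlim : ∀ x, Tendsto (fun N => ‖x - P N x‖) atTop (nhds 0))
    (hPinner : ∀ N x, (inner ℂ x (P N (X (P N x)))).re = 0)
    {K : Set E} (hK : IsCompact K) {U : E → ℝ → E} {V : ℕ → E → ℝ → E}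
    (hU : ∀ x ∈ K, IsTrajectory X (U x) ∧ U x 0 = x)
    (hV : ∀ N, ∀ x ∈ K, IsTrajectory (fun x => P N (X (P N x))) (V N x) ∧ V N x 0 = P N x)
    {ε : ℝ} (hε : 0 < ε) :
    ∀ᶠ N in atTop, ∀ x ∈ K, ∀ t ∈ Icc (0 : ℝ) 1, ‖U x t - V N x t‖ ≤ ε := by
  obtain ⟨R, hR⟩ := hK.isBounded.exists_norm_le
  obtain ⟨L, hL1, hL⟩ := hX R
  have hLN := fun N => hL.comp_contraction hPsub hPnorm N
  have hUR : ∀ x ∈ K, ∀ t, ‖U x t‖ ≤ R := fun x hx t => by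
    rw [(hU x hx).1.norm_eq hXinner, (hU x hx).2]
    exact hR x hx
  have hVR : ∀ N, ∀ x ∈ K, ∀ t, ‖V N x t‖ ≤ R := fun N x hx t => by
    rw [(hV N x hx).1.norm_eq (hPinner N), (hV N x hx).2]
    exact (hPnorm N x).trans (hR x hx)
  refine hK.eventually_forall_le_of_equiLipschitz (B := Icc (0 : ℝ) 1)
    (g := fun N x t => ‖U x t - V N x t‖) (C := 2 * Real.exp L) (by positivity) ?_ ?_ hε
  · intro N x hx y hy t ht
    have h1 : ‖U x t - U y t‖ ≤ (dist x y + 0) * Real.exp L :=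
      dist_le_exp_of_approx_trajectory hL1 hL dist_nonneg le_rfl (hU x hx).1.hasDerivAt (by simp)
        (hUR x hx) (hU y hy).1.hasDerivAt (hUR y hy)
        (by rw [(hU x hx).2, (hU y hy).2, dist_eq_norm]) ht
    have h2 : ‖V N x t - V N y t‖ ≤ (dist x y + 0) * Real.exp L :=
      dist_le_exp_of_approx_trajectory hL1 (hLN N) dist_nonneg le_rfl (hV N x hx).1.hasDerivAt
        (by simp) (hVR N x hx) (hV N y hy).1.hasDerivAt (hVR N y hy)
        (by rw [(hV N x hx).2, (hV N y hy).2, dist_eq_norm, ← hPsub]; exact hPnorm _ _) ht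
    have h3 : U x t - V N x t = (U y t - V N y t) + ((U x t - U y t) - (V N x t - V N y t)) := by
      abel
    have h4 := norm_add_le (U y t - V N y t) ((U x t - U y t) - (V N x t - V N y t))
    have h5 := norm_sub_le (U x t - U y t) (V N x t - V N y t)
    rw [← h3] at h4
    linarith
  · intro x hx ε hε
    have hcont : Continuous (U x) :=
      continuous_iff_continuousAt.2 fun t => ((hU x hx).1.hasDerivAt t).continuousAt
    have hXcont : ContinuousOn (fun t => X (U x t)) (Icc 0 1) :=
      hL.continuousOn.comp hcont.continuousOn fun t _ => by simpa using hUR x hx t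
    have hη : 0 < ε / ((2 + L) * Real.exp L) := by positivity
    set η := ε / ((2 + L) * Real.exp L) with hηdef
    have hc1 := eventually_norm_sub_le_of_isCompact hPsub hPnorm hPlim
      (isCompact_Icc.image hcont : IsCompact (U x '' Icc (0 : ℝ) 1)) hη
    have hc2 := eventually_norm_sub_le_of_isCompact hPsub hPnorm hPlim
      (isCompact_Icc.image_of_continuousOn hXcont) hη
    filter_upwards [hc1, hc2] with N h1 h2 t ht
    have herr : ∀ s ∈ Icc (0 : ℝ) 1, ‖X (U x s) - P N (X (P N (U x s)))‖ ≤ (1 + L) * η := by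
      intro s hs
      have e1 := h1 _ (mem_image_of_mem _ hs)
      have e2 := h2 _ (mem_image_of_mem _ hs)
      have e3 := hL.dist_le_mul (U x s) (by simpa using hUR x hx s) (P N (U x s))
        (by simpa using (hPnorm N _).trans (hUR x hx s))
      rw [dist_eq_norm, dist_eq_norm] at e3
      have e4 := hPnorm N (X (U x s) - X (P N (U x s)))
      have e5 := norm_add_le (X (U x s) - P N (X (U x s))) (P N (X (U x s) - X (P N (U x s))))
      have e6 := mul_le_mul_of_nonneg_left e1 L.2
      rw [hPsub N (X (U x s)), sub_add_sub_cancel, ← hPsub] at e5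
      change (L : ℝ) * _ ≤ L * _ at e6
      linarith
    have h0 : ‖U x 0 - V N x 0‖ ≤ η := by
      have := h1 _ (mem_image_of_mem _ (left_mem_Icc.2 zero_le_one))
      rw [(hU x hx).2] at this ⊢
      rw [(hV N x hx).2]
      exact this
    have h := dist_le_exp_of_approx_trajectory hL1 (hLN N) hη.le (by positivity)
      (hU x hx).1.hasDerivAt herr (hUR x hx) (hV N x hx).1.hasDerivAt (hVR N x hx) h0 ht
    refine h.trans (le_of_eq ?_)
    rw [hηdef]
    field_simp
    ring

/-- Two-sided version of `eventually_norm_galerkin_sub_le_of_mem_Icc`. -/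
theorem eventually_norm_galerkin_sub_le
    (hX : ∀ R : ℝ, ∃ L : ℝ≥0, 1 ≤ L ∧ LipschitzOnWith L X (closedBall 0 R))
    (hXinner : ∀ x, (inner ℂ x (X x)).re = 0)
    (hPsub : ∀ N x y, P N (x - y) = P N x - P N y) (hPnorm : ∀ N x, ‖P N x‖ ≤ ‖x‖)
    (hPlim : ∀ x, Tendsto (fun N => ‖x - P N x‖) atTop (nhds 0))
    (hPinner : ∀ N x, (inner ℂ x (P N (X (P N x)))).re = 0)
    {K : Set E} (hK : IsCompact K) {U : E → ℝ → E} {V : ℕ → E → ℝ → E}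
    (hU : ∀ x ∈ K, IsTrajectory X (U x) ∧ U x 0 = x)
    (hV : ∀ N, ∀ x ∈ K, IsTrajectory (fun x => P N (X (P N x))) (V N x) ∧ V N x 0 = P N x)
    {ε : ℝ} (hε : 0 < ε) :
    ∀ᶠ N in atTop, ∀ x ∈ K, ∀ t : ℝ, |t| ≤ 1 → ‖U x t - V N x t‖ ≤ ε := by
  have hPneg : ∀ N x, P N (-x) = -P N x := fun N x => by
    have h0 := hPsub N 0 0
    have h1 := hPsub N 0 x
    rw [sub_self, sub_self] at h0
    rw [zero_sub, h0, zero_sub] at h1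
    exact h1
  have hpos := eventually_norm_galerkin_sub_le_of_mem_Icc hX hXinner hPsub hPnorm hPlim hPinner
    hK hU hV hε
  have hneg := eventually_norm_galerkin_sub_le_of_mem_Icc (X := fun x => -X x) (P := P)
    (U := fun x t => U x (-t)) (V := fun N x t => V N x (-t))
    (fun R => (hX R).imp fun L hL => ⟨hL.1, hL.2.neg⟩)
    (fun x => by simp [inner_neg_right, hXinner x]) hPsub hPnorm hPlim
    (fun N x => by simp [inner_neg_right, hPneg, hPinner N x]) hK
    (fun x hx => ⟨(hU x hx).1.comp_neg, by simpa using (hU x hx).2⟩)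
    (fun N x hx => ⟨by simpa only [hPneg] using (hV N x hx).1.comp_neg,
      by simpa using (hV N x hx).2⟩) hε
  filter_upwards [hpos, hneg] with N h1 h2 x hx t ht
  rcases le_total 0 t with h | h
  · exact h1 x hx t ⟨h, (le_abs_self t).trans ht⟩
  · simpa using h2 x hx (-t) ⟨by linarith, (neg_le_abs t).trans ht⟩

end AbstractFlow

section SquareSummable

/-- The Hilbert space of square-summable sequences on `ℤ`. -/
abbrev L2Z : Type := lp (fun _ : ℤ => ℂ) 2

lemma memlp_two_iff {f : ℤ → ℂ} : Memℓp f 2 ↔ Summable fun n => ‖f n‖ ^ 2 := by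
  rw [memℓp_gen_iff (by norm_num)]
  simp

lemma L2Z.hasSum_norm_sq (x : L2Z) : HasSum (fun n => ‖x n‖ ^ 2) (‖x‖ ^ 2) := by
  have h := lp.hasSum_norm (p := 2) (by norm_num) x
  simpa using h

lemma L2Z.hasSum_norm_sq_add_left (x : L2Z) (n : ℤ) :
    HasSum (fun a => ‖x (n + a)‖ ^ 2) (‖x‖ ^ 2) :=
  (Equiv.addLeft n).hasSum_iff.2 x.hasSum_norm_sq

lemma HasSum.mul_prod_of_nonneg {ι κ : Type*} {f : ι → ℝ} {g : κ → ℝ} {A B : ℝ}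
    (hf : HasSum f A) (hg : HasSum g B) (hf0 : 0 ≤ f) (hg0 : 0 ≤ g) :
    HasSum (fun q : ι × κ => f q.1 * g q.2) (A * B) :=
  hf.mul hg (hf.summable.mul_of_nonneg hg.summable hf0 hg0)

lemma summable_mul_and_tsum_sq_le {ι : Type*} {f g : ι → ℝ} (hf : ∀ i, 0 ≤ f i)
    (hg : ∀ i, 0 ≤ g i) (hfs : Summable fun i => f i ^ 2) (hgs : Summable fun i => g i ^ 2) :
    (Summable fun i => f i * g i) ∧
      (∑' i, f i * g i) ^ 2 ≤ (∑' i, f i ^ 2) * ∑' i, g i ^ 2 := by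
  have h := Real.summable_and_inner_le_Lp_mul_Lq_tsum_of_nonneg (p := 2) (q := 2)
    Real.HolderConjugate.two_two hf hg (by simpa using hfs) (by simpa using hgs)
  refine ⟨h.1, ?_⟩
  have h0 : 0 ≤ ∑' i, f i * g i := tsum_nonneg fun i => mul_nonneg (hf i) (hg i)
  have h2 := pow_le_pow_left₀ h0 h.2 2
  simp only [Real.rpow_ofNat, ← Real.sqrt_eq_rpow] at h2
  rwa [mul_pow, Real.sq_sqrt (tsum_nonneg fun i => sq_nonneg _),
    Real.sq_sqrt (tsum_nonneg fun i => sq_nonneg _)] at h2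

end SquareSummable

section BirkhoffField

/-- The multiplier `-σ / Φ₁` in the shifted variables `(j₁ - n, j₂ - n)`; it vanishes on
resonant pairs by the convention `σ / 0 = 0`. -/
def birkhoffKernel (σ : ℝ) (p : ℤ × ℤ) : ℝ := σ / (2 * p.1 * p.2)

/-- The general term of the trilinear Birkhoff form. -/
def birkhoffTerm (σ : ℝ) (u v w : ℤ → ℂ) (n : ℤ) (p : ℤ × ℤ) : ℂ :=
  (birkhoffKernel σ p : ℂ) * (u (n + p.1) * v (n + p.2) * conj (w (n + p.1 + p.2)))

lemma summable_birkhoffKernel_sq (σ : ℝ) : Summable fun p => birkhoffKernel σ p ^ 2 := by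
  have h : Summable fun n : ℤ => 1 / (n : ℝ) ^ 2 := Real.summable_one_div_int_pow.2 one_lt_two
  have h2 := (h.mul_of_nonneg h (fun n => by positivity) (fun n => by positivity)).mul_left
    (σ ^ 2 / 4)
  refine h2.congr fun p => ?_
  unfold birkhoffKernel
  rw [div_pow, mul_pow, mul_pow, div_mul_div_comm, div_mul_div_comm]
  norm_num
  ring

/-- The square of the `ℓ²` operator bound for the trilinear Birkhoff form. -/
def birkhoffBoundSq (σ : ℝ) : ℝ := ∑' p, birkhoffKernel σ p ^ 2

lemma hasSum_birkhoffKernel_mul_sq (σ : ℝ) (w : L2Z) :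
    HasSum (fun q : ℤ × (ℤ × ℤ) =>
      (|birkhoffKernel σ q.2| * ‖w (q.1 + q.2.1 + q.2.2)‖) ^ 2) (birkhoffBoundSq σ * ‖w‖ ^ 2) := by
  have h := (summable_birkhoffKernel_sq σ).hasSum.mul_prod_of_nonneg w.hasSum_norm_sq
    (fun p => sq_nonneg _) (fun n => sq_nonneg _)
  let e : ℤ × (ℤ × ℤ) ≃ (ℤ × ℤ) × ℤ :=
    { toFun := fun q => (q.2, q.1 + q.2.1 + q.2.2)
      invFun := fun q => (q.2 - q.1.1 - q.1.2, q.1)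
      left_inv := fun q => by ext <;> simp; ring
      right_inv := fun q => by ext <;> simp; ring }
  convert e.hasSum_iff.2 h using 2 with q
  · simp [e, mul_pow]
  · rfl

lemma norm_birkhoffTerm (σ : ℝ) (u v w : ℤ → ℂ) (n : ℤ) (p : ℤ × ℤ) :
    ‖birkhoffTerm σ u v w n p‖ = (|birkhoffKernel σ p| * ‖w (n + p.1 + p.2)‖) *
      (‖u (n + p.1)‖ * ‖v (n + p.2)‖) := by
  simp only [birkhoffTerm, norm_mul, Complex.norm_real, Real.norm_eq_abs, RCLike.norm_conj]
  ring

lemma hasSum_norm_mul_norm_sq (u v : L2Z) (n : ℤ) :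
    HasSum (fun p : ℤ × ℤ => (‖u (n + p.1)‖ * ‖v (n + p.2)‖) ^ 2) (‖u‖ ^ 2 * ‖v‖ ^ 2) := by
  simp only [mul_pow]
  exact (u.hasSum_norm_sq_add_left n).mul_prod_of_nonneg (v.hasSum_norm_sq_add_left n)
    (fun p => sq_nonneg _) (fun p => sq_nonneg _)

lemma summable_birkhoffTerm_and_norm_tsum_sq_le (σ : ℝ) (u v w : L2Z) (n : ℤ) :
    Summable (birkhoffTerm σ u v w n) ∧ ‖∑' p, birkhoffTerm σ u v w n p‖ ^ 2 ≤
      (∑' p : ℤ × ℤ, (|birkhoffKernel σ p| * ‖w (n + p.1 + p.2)‖) ^ 2) *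
        (‖u‖ ^ 2 * ‖v‖ ^ 2) := by
  have h := summable_mul_and_tsum_sq_le (fun p => by positivity) (fun p => by positivity)
    ((hasSum_birkhoffKernel_mul_sq σ w).summable.prod_factor n)
    (hasSum_norm_mul_norm_sq u v n).summable
  simp only [← norm_birkhoffTerm] at h
  refine ⟨h.1.of_norm, ?_⟩
  rw [← (hasSum_norm_mul_norm_sq u v n).tsum_eq]
  exact (pow_le_pow_left₀ (norm_nonneg _) (norm_tsum_le_tsum_norm h.1) 2).trans h.2

lemma summable_norm_tsum_birkhoffTerm_sq (σ : ℝ) (u v w : L2Z) :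
    (Summable fun n => ‖∑' p, birkhoffTerm σ u v w n p‖ ^ 2) ∧
      ∑' n, ‖∑' p, birkhoffTerm σ u v w n p‖ ^ 2 ≤
        birkhoffBoundSq σ * ‖w‖ ^ 2 * (‖u‖ ^ 2 * ‖v‖ ^ 2) := by
  have hK := hasSum_birkhoffKernel_mul_sq σ w
  have hs := hK.summable.prod.mul_right (‖u‖ ^ 2 * ‖v‖ ^ 2)
  have hle := fun n => (summable_birkhoffTerm_and_norm_tsum_sq_le σ u v w n).2
  have hsum := Summable.of_nonneg_of_le (fun n => sq_nonneg _) hle hs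
  refine ⟨hsum, (hsum.tsum_le_tsum hle hs).trans (le_of_eq ?_)⟩
  rw [tsum_mul_right, ← hK.summable.tsum_prod, hK.tsum_eq]

/-- The trilinear Birkhoff form on `ℓ²`. -/
def birkhoffForm (σ : ℝ) (u v w : L2Z) : L2Z :=
  ⟨fun n => ∑' p, birkhoffTerm σ u v w n p,
    memlp_two_iff.2 (summable_norm_tsum_birkhoffTerm_sq σ u v w).1⟩

lemma hasSum_birkhoffForm (σ : ℝ) (u v w : L2Z) (n : ℤ) :
    HasSum (birkhoffTerm σ u v w n) (birkhoffForm σ u v w n) :=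
  (summable_birkhoffTerm_and_norm_tsum_sq_le σ u v w n).1.hasSum

lemma norm_birkhoffForm_le (σ : ℝ) (u v w : L2Z) :
    ‖birkhoffForm σ u v w‖ ≤ √(birkhoffBoundSq σ) * (‖u‖ * ‖v‖ * ‖w‖) := by
  have h0 : 0 ≤ birkhoffBoundSq σ := tsum_nonneg fun p => sq_nonneg _
  refine (sq_le_sq₀ (norm_nonneg _) (by positivity)).1 ?_
  rw [mul_pow, Real.sq_sqrt h0, ← (birkhoffForm σ u v w).hasSum_norm_sq.tsum_eq]
  refine (summable_norm_tsum_birkhoffTerm_sq σ u v w).2.trans (le_of_eq ?_)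
  ring

/-- The Birkhoff vector field on `ℓ²`. -/
def birkhoffField (σ : ℝ) (u : L2Z) : L2Z := birkhoffForm σ u u u

lemma birkhoffField_sub (σ : ℝ) (u v : L2Z) :
    birkhoffField σ u - birkhoffField σ v = birkhoffForm σ (u - v) u u +
      birkhoffForm σ v (u - v) u + birkhoffForm σ v v (u - v) := by
  ext n
  have h := ((hasSum_birkhoffForm σ (u - v) u u n).add (hasSum_birkhoffForm σ v (u - v) u n)).add
    (hasSum_birkhoffForm σ v v (u - v) n)
  have hterm : ∀ p, birkhoffTerm σ u u u n p - birkhoffTerm σ v v v n p =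
      birkhoffTerm σ (u - v : L2Z) u u n p + birkhoffTerm σ v (u - v : L2Z) u n p +
        birkhoffTerm σ v v (u - v : L2Z) n p := fun p => by
    simp only [birkhoffTerm, lp.coeFn_sub, Pi.sub_apply, map_sub]
    ring
  simp only [← hterm] at h
  exact ((hasSum_birkhoffForm σ u u u n).sub (hasSum_birkhoffForm σ v v v n)).unique h

lemma exists_lipschitzOnWith_birkhoffField (σ R : ℝ) :
    ∃ L : NNReal, 1 ≤ L ∧ LipschitzOnWith L (birkhoffField σ) (Metric.closedBall 0 R) := by
  refine ⟨max 1 (Real.toNNReal (3 * √(birkhoffBoundSq σ) * R ^ 2)), le_max_left _ _,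
    LipschitzOnWith.of_dist_le_mul fun u hu v hv => ?_⟩
  rw [mem_closedBall_zero_iff] at hu hv
  rw [dist_eq_norm, dist_eq_norm, birkhoffField_sub]
  set C := √(birkhoffBoundSq σ)
  have hC : 0 ≤ C := Real.sqrt_nonneg _
  have hR : 0 ≤ R := (norm_nonneg u).trans hu
  have key : ∀ a b : L2Z, ‖a‖ ≤ R → ‖b‖ ≤ R → ‖a‖ * ‖b‖ ≤ R ^ 2 := fun a b ha hb => by
    rw [sq]
    exact mul_le_mul ha hb (norm_nonneg _) hR
  have hd : 0 ≤ C * ‖u - v‖ := by positivity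
  have h1 := norm_birkhoffForm_le σ (u - v) u u
  have h2 := norm_birkhoffForm_le σ v (u - v) u
  have h3 := norm_birkhoffForm_le σ v v (u - v)
  have k1 := mul_le_mul_of_nonneg_left (key u u hu hu) hd
  have k2 := mul_le_mul_of_nonneg_left (key v u hv hu) hd
  have k3 := mul_le_mul_of_nonneg_left (key v v hv hv) hd
  have hL : 3 * C * R ^ 2 ≤ (max 1 (Real.toNNReal (3 * C * R ^ 2)) : NNReal) :=
    (Real.le_coe_toNNReal _).trans (NNReal.coe_le_coe.2 (le_max_right _ _))
  have hL' := mul_le_mul_of_nonneg_right hL (norm_nonneg (u - v))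
  refine le_trans (norm_add₃_le) (le_trans ?_ hL')
  simp only [C] at *
  linarith

lemma summable_birkhoffTerm_mul_conj (σ : ℝ) (u : L2Z) :
    Summable fun q : ℤ × (ℤ × ℤ) => birkhoffTerm σ u u u q.1 q.2 * starRingEnd ℂ (u q.1) := by
  have hu0 : (0 : ℤ → ℝ) ≤ fun n => ‖u n‖ ^ 2 := fun n => sq_nonneg _
  have hg : Summable fun q : ℤ × (ℤ × ℤ) =>
      (‖u (q.1 + q.2.1)‖ * ‖u (q.1 + q.2.2)‖ * ‖u q.1‖) ^ 2 := by
    have h3 := u.hasSum_norm_sq.mul_prod_of_nonneg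
      (u.hasSum_norm_sq.mul_prod_of_nonneg u.hasSum_norm_sq hu0 hu0) hu0
      (fun p => by positivity)
    let e : ℤ × (ℤ × ℤ) ≃ ℤ × (ℤ × ℤ) :=
      { toFun := fun q => (q.1, q.1 + q.2.1, q.1 + q.2.2)
        invFun := fun q => (q.1, q.2.1 - q.1, q.2.2 - q.1)
        left_inv := fun q => by ext <;> simp
        right_inv := fun q => by ext <;> simp }
    refine (e.summable_iff.2 h3.summable).congr fun q => ?_
    simp only [e, Function.comp_apply, Equiv.coe_fn_mk]
    ring
  have h := (summable_mul_and_tsum_sq_le (fun q => by positivity) (fun q => by positivity)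
    (hasSum_birkhoffKernel_mul_sq σ u).summable hg).1
  refine Summable.of_norm (h.congr fun q => ?_)
  rw [norm_mul, norm_birkhoffTerm, RCLike.norm_conj]
  ring

lemma re_inner_birkhoffField (σ : ℝ) (u : L2Z) : (inner ℂ u (birkhoffField σ u)).re = 0 := by
  let F : ℤ × (ℤ × ℤ) → ℂ := fun q => birkhoffTerm σ u u u q.1 q.2 * starRingEnd ℂ (u q.1)
  have hS : inner ℂ u (birkhoffField σ u) = ∑' q, F q := by
    rw [lp.inner_eq_tsum, (summable_birkhoffTerm_mul_conj σ u).tsum_prod]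
    refine tsum_congr fun n => ?_
    rw [RCLike.inner_apply]
    exact (tsum_mul_right ..).symm
  let e : ℤ × (ℤ × ℤ) ≃ ℤ × (ℤ × ℤ) :=
    { toFun := fun q => (q.1 + q.2.1, -q.2.1, q.2.2)
      invFun := fun q => (q.1 + q.2.1, -q.2.1, q.2.2)
      left_inv := fun q => by ext <;> simp
      right_inv := fun q => by ext <;> simp }
  have hanti : ∀ q, F (e q) = -conj (F q) := fun q => by
    have e1 : q.1 + q.2.1 + -q.2.1 = q.1 := by ring
    simp only [F, e, Equiv.coe_fn_mk, birkhoffTerm, birkhoffKernel, e1, map_mul,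
      Complex.conj_ofReal, Complex.conj_conj]
    push_cast
    rw [mul_neg, neg_mul, div_neg]
    ring
  have hneg : ∑' q, F q = -conj (∑' q, F q) := by
    conv_lhs => rw [← e.tsum_eq F]
    simp only [hanti]
    rw [tsum_neg, Complex.conj_tsum]
  rw [hS]
  have := congrArg Complex.re hneg
  rw [Complex.neg_re, Complex.conj_re] at this
  linarith

end BirkhoffField

section Truncation

lemma trunc_sub (N : ℕ) (u v : ℤ → ℂ) : trunc N (u - v) = trunc N u - trunc N v := by
  ext n
  simp only [trunc, Pi.sub_apply]
  split_ifs <;> simp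

lemma norm_trunc_le (N : ℕ) (u : ℤ → ℂ) (n : ℤ) : ‖trunc N u n‖ ≤ ‖u n‖ := by
  unfold trunc
  split_ifs <;> simp

lemma norm_trunc_sq_le (N : ℕ) (u : ℤ → ℂ) (n : ℤ) : ‖trunc N u n‖ ^ 2 ≤ ‖u n‖ ^ 2 :=
  pow_le_pow_left₀ (norm_nonneg _) (norm_trunc_le N u n) 2

/-- Frequency truncation on `ℓ²`. -/
def truncL2 (N : ℕ) (u : L2Z) : L2Z :=
  ⟨trunc N u, memlp_two_iff.2 (u.hasSum_norm_sq.summable.of_nonneg_of_le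
    (fun _ => sq_nonneg _) (norm_trunc_sq_le N u))⟩

lemma coe_truncL2 (N : ℕ) (u : L2Z) : ⇑(truncL2 N u) = trunc N u := rfl

lemma truncL2_sub (N : ℕ) (u v : L2Z) : truncL2 N (u - v) = truncL2 N u - truncL2 N v :=
  lp.ext (trunc_sub N u v)

lemma norm_truncL2_le (N : ℕ) (u : L2Z) : ‖truncL2 N u‖ ≤ ‖u‖ :=
  (sq_le_sq₀ (norm_nonneg _) (norm_nonneg _)).1 <|
    hasSum_le (norm_trunc_sq_le N u) (truncL2 N u).hasSum_norm_sq u.hasSum_norm_sq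

lemma tendsto_norm_sub_truncL2 (u : L2Z) :
    Tendsto (fun N => ‖u - truncL2 N u‖) atTop (nhds 0) := by
  have hbound : ∀ N n, ‖u n - trunc N u n‖ ≤ ‖u n‖ := fun N n => by
    unfold trunc
    split_ifs <;> simp
  have h : Tendsto (fun N => ∑' n, ‖u n - trunc N u n‖ ^ 2) atTop (nhds (∑' _ : ℤ, (0 : ℝ))) := by
    refine tendsto_tsum_of_dominated_convergence u.hasSum_norm_sq.summable (fun n => ?_)
      (Eventually.of_forall fun N n => ?_)
    · refine tendsto_const_nhds.congr' ?_
      filter_upwards [eventually_ge_atTop n.natAbs] with N hN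
      simp [trunc, hN]
    · rw [norm_pow, norm_norm]
      exact pow_le_pow_left₀ (norm_nonneg _) (hbound N n) 2
  have h2 : ∀ N, ∑' n, ‖u n - trunc N u n‖ ^ 2 = ‖u - truncL2 N u‖ ^ 2 := fun N =>
    (u - truncL2 N u).hasSum_norm_sq.tsum_eq
  simp only [h2, tsum_zero] at h
  simpa [Real.sqrt_sq] using h.sqrt

lemma inner_truncL2_right (N : ℕ) (u v : L2Z) :
    inner ℂ u (truncL2 N v) = inner ℂ (truncL2 N u) v := by
  rw [lp.inner_eq_tsum, lp.inner_eq_tsum]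
  refine tsum_congr fun n => ?_
  simp only [coe_truncL2, trunc]
  split_ifs <;> simp

lemma res_one_add (n a b : ℤ) : res 1 (n + a) (n + b) (n + a + b) = -(2 * a * b) := by
  have h : n + a + (n + b) - (n + a + b) = n := by ring
  simp only [res, h, mul_one, Real.rpow_two, sq_abs]
  push_cast
  ring

lemma XB_one_top (σ : ℝ) (u : L2Z) : XB 1 σ ⊤ u = birkhoffField σ u := by
  ext n
  have hn : ∀ j, inBall ⊤ j := fun j => le_top
  let e : ℤ × ℤ ≃ ℤ × ℤ := (Equiv.addLeft n).prodCongr (Equiv.addLeft n)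
  simp only [XB, hn, if_true, true_and]
  rw [← e.tsum_eq]
  refine tsum_congr fun p => ?_
  have hp : n + p.1 + (n + p.2) - n = n + p.1 + p.2 := by ring
  simp only [e, Equiv.prodCongr_apply, Prod.map, Equiv.coe_addLeft, hp, res_one_add,
    birkhoffTerm, birkhoffKernel]
  split_ifs with h
  · rw [neg_div_neg_eq]
  · rw [not_not, neg_eq_zero] at h
    simp [h]

lemma XB_coe_nat (α σ : ℝ) (N : ℕ) (u : ℤ → ℂ) :
    XB α σ N u = trunc N (XB α σ ⊤ (trunc N u)) := by
  ext n
  have hb : ∀ j, inBall N j ↔ j.natAbs ≤ N := fun j => Nat.cast_le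
  have ht : ∀ j, inBall ⊤ j := fun j => le_top
  simp only [XB, trunc, hb, ht, if_true, true_and]
  refine if_congr Iff.rfl (tsum_congr fun p => ?_) rfl
  by_cases h1 : p.1.natAbs ≤ N <;> by_cases h2 : p.2.natAbs ≤ N <;>
    by_cases h3 : (p.1 + p.2 - n).natAbs ≤ N <;> simp [h1, h2, h3]

lemma XB_one_coe_nat (σ : ℝ) (N : ℕ) (u : L2Z) :
    XB 1 σ N u = truncL2 N (birkhoffField σ (truncL2 N u)) := by
  rw [XB_coe_nat, coe_truncL2, ← XB_one_top, coe_truncL2]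

end Truncation

section Transfer

lemma hsE_zero (u : ℤ → ℂ) :
    hsE 0 u = (∑' n : ℤ, ENNReal.ofReal (2 * ‖u n‖ ^ 2)) ^ ((1 : ℝ) / 2) := by
  unfold hsE
  congr 1
  refine tsum_congr fun n => ?_
  rw [ENNReal.ofReal_mul two_pos.le, ENNReal.ofReal_pow (norm_nonneg _), ofReal_norm]
  norm_num
  rfl

lemma memlp_two_of_hsE_ne_top {u : ℤ → ℂ} (hu : hsE 0 u ≠ ⊤) : Memℓp u 2 := by
  rw [memlp_two_iff]
  have h : ∑' n : ℤ, ENNReal.ofReal (2 * ‖u n‖ ^ 2) ≠ ⊤ := fun h => hu (by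
    rw [hsE_zero, h, ENNReal.top_rpow_of_pos (by norm_num)])
  have hs := (ENNReal.summable_toReal h).mul_left (1 / 2)
  refine hs.congr fun n => ?_
  rw [ENNReal.toReal_ofReal (by positivity)]
  ring

lemma hsE_zero_coe (x : L2Z) : hsE 0 x = ENNReal.ofReal (√2 * ‖x‖) := by
  have h := x.hasSum_norm_sq.mul_left 2
  rw [hsE_zero, ← ENNReal.ofReal_tsum_of_nonneg (fun n => by positivity) h.summable, h.tsum_eq,
    ENNReal.ofReal_rpow_of_nonneg (by positivity) (by norm_num), ← Real.sqrt_eq_rpow,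
    Real.sqrt_mul two_pos.le, Real.sqrt_sq (norm_nonneg _)]

/-- A sequence as an element of `ℓ²`, with value `0` if it is not square-summable. -/
def toL2Z (u : ℤ → ℂ) : L2Z := if h : Memℓp u 2 then ⟨u, h⟩ else 0

lemma coe_toL2Z {u : ℤ → ℂ} (hu : hsE 0 u ≠ ⊤) : ⇑(toL2Z u) = u := by
  rw [toL2Z, dif_pos (memlp_two_of_hsE_ne_top hu)]

lemma toL2Z_coe (x : L2Z) : toL2Z x = x :=
  lp.ext (coe_toL2Z (by rw [hsE_zero_coe]; exact ENNReal.ofReal_ne_top))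

lemma IsSol.isTrajectory {α σ : ℝ} {N : ℕ∞} {U : ℝ → ℤ → ℂ} (hU : IsSol α σ N 0 U)
    {Y : L2Z → L2Z} (hY : ∀ x : L2Z, XB α σ N x = Y x) :
    IsTrajectory Y (fun t => toL2Z (U t)) := by
  intro t
  have hcoe : ∀ t, ⇑(toL2Z (U t)) = U t := fun t => coe_toL2Z (hU t).1
  have h := (hU t).2
  have heq : ∀ h : ℝ, (fun n => (U (t + h) n - U t n) / (h : ℂ) - XB α σ N (U t) n) =
      ⇑(((h : ℂ)⁻¹) • (toL2Z (U (t + h)) - toL2Z (U t)) - Y (toL2Z (U t))) := fun h => by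
    ext n
    rw [lp.coeFn_sub, lp.coeFn_smul, lp.coeFn_sub, ← hY]
    simp only [Pi.sub_apply, Pi.smul_apply, smul_eq_mul, hcoe]
    rw [div_eq_inv_mul]
  simp only [HasHsDerivAt, heq, hsE_zero_coe] at h
  have h2 := ((ENNReal.tendsto_toReal ENNReal.zero_ne_top).comp h).const_mul (√2)⁻¹
  rw [ENNReal.toReal_zero, mul_zero] at h2
  refine h2.congr fun s => ?_
  rw [Function.comp_apply, ENNReal.toReal_ofReal (by positivity),
    inv_mul_cancel_left₀ (by positivity)]

/-- Uniform convergence of the truncated Birkhoff flows over a compact set of initial data. -/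
theorem exists_forall_hsE_sub_le (σ : ℝ) {K : Set L2Z} (hK : IsCompact K)
    {U : L2Z → ℝ → ℤ → ℂ} {V : ℕ → L2Z → ℝ → ℤ → ℂ}
    (hU : ∀ x ∈ K, IsSol 1 σ ⊤ 0 (U x) ∧ U x 0 = ⇑x)
    (hV : ∀ N : ℕ, ∀ x ∈ K, IsSol 1 σ (N : ℕ∞) 0 (V N x) ∧ V N x 0 = trunc N ⇑x)
    {ε : ℝ} (hε : 0 < ε) :
    ∃ N₀ : ℕ, ∀ N : ℕ, N₀ ≤ N → ∀ x ∈ K, ∀ τ : ℝ, |τ| ≤ 1 →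
      hsE 0 (fun n => U x τ n - V N x τ n) ≤ ENNReal.ofReal ε := by
  have h := eventually_norm_galerkin_sub_le (X := birkhoffField σ) (P := truncL2)
    (U := fun x t => toL2Z (U x t)) (V := fun N x t => toL2Z (V N x t))
    (exists_lipschitzOnWith_birkhoffField σ) (re_inner_birkhoffField σ) truncL2_sub
    norm_truncL2_le tendsto_norm_sub_truncL2
    (fun N x => by rw [inner_truncL2_right, re_inner_birkhoffField]) hK
    (fun x hx => ⟨(hU x hx).1.isTrajectory (XB_one_top σ), by
      rw [(hU x hx).2, toL2Z_coe]⟩)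
    (fun N x hx => ⟨(hV N x hx).1.isTrajectory (XB_one_coe_nat σ N), by
      rw [(hV N x hx).2, ← coe_truncL2, toL2Z_coe]⟩)
    (show 0 < ε / √2 by positivity)
  obtain ⟨N₀, hN₀⟩ := eventually_atTop.1 h
  refine ⟨N₀, fun N hN x hx τ hτ => ?_⟩
  have hcoe : (fun n => U x τ n - V N x τ n) = ⇑(toL2Z (U x τ) - toL2Z (V N x τ)) := by
    ext n
    rw [lp.coeFn_sub, Pi.sub_apply, coe_toL2Z ((hU x hx).1 τ).1, coe_toL2Z ((hV N x hx).1 τ).1]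
  rw [hcoe, hsE_zero_coe]
  refine ENNReal.ofReal_le_ofReal ?_
  rw [mul_comm]
  exact (le_div_iff₀ (by positivity)).1 (hN₀ N hN x hx τ hτ)

end Transfer

/-- Convergence of the truncated Birkhoff flow to the full flow (`α = 1`), pointwise on `ℓ²`
and uniformly on `ℓ²`-compact sets. -/
theorem statement_6 (σ : ℝ) (hσ : σ = 1 ∨ σ = -1) :
    (∀ u₀ : ℤ → ℂ, hsE 0 u₀ ≠ ⊤ →
      ∀ U : ℝ → ℤ → ℂ, IsSol 1 σ ⊤ 0 U → U 0 = u₀ →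
      ∀ V : ℕ → ℝ → ℤ → ℂ,
        (∀ N : ℕ, IsSol 1 σ (N : ℕ∞) 0 (V N) ∧ V N 0 = trunc N u₀) →
        ∀ ε : ℝ, 0 < ε → ∃ N₀ : ℕ, ∀ N : ℕ, N₀ ≤ N → ∀ τ : ℝ, |τ| ≤ 1 →
          hsE 0 (fun n => U τ n - V N τ n) ≤ ENNReal.ofReal ε) ∧
    (∀ K : Set (lp (fun _ : ℤ => ℂ) 2), IsCompact K →
      ∀ U : lp (fun _ : ℤ => ℂ) 2 → ℝ → ℤ → ℂ,
      ∀ V : ℕ → lp (fun _ : ℤ => ℂ) 2 → ℝ → ℤ → ℂ,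
        (∀ x ∈ K, IsSol 1 σ ⊤ 0 (U x) ∧ U x 0 = ⇑x) →
        (∀ N : ℕ, ∀ x ∈ K, IsSol 1 σ (N : ℕ∞) 0 (V N x) ∧ V N x 0 = trunc N ⇑x) →
        ∀ ε : ℝ, 0 < ε → ∃ N₀ : ℕ, ∀ N : ℕ, N₀ ≤ N → ∀ x ∈ K, ∀ τ : ℝ, |τ| ≤ 1 →
          hsE 0 (fun n => U x τ n - V N x τ n) ≤ ENNReal.ofReal ε) := by
  refine ⟨fun u₀ hu₀ U hU hU0 V hV ε hε => ?_, fun K hK U V hU hV ε hε =>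
    exists_forall_hsE_sub_le σ hK hU hV hε⟩
  obtain ⟨N₀, hN₀⟩ := exists_forall_hsE_sub_le σ (isCompact_singleton (x := toL2Z u₀))
    (U := fun _ => U) (V := fun N _ => V N)
    (fun x hx => ⟨hU, by rw [mem_singleton_iff.1 hx, coe_toL2Z hu₀, hU0]⟩)
    (fun N x hx => ⟨(hV N).1, by rw [mem_singleton_iff.1 hx, coe_toL2Z hu₀, (hV N).2]⟩) hε
  exact ⟨N₀, fun N hN τ hτ => hN₀ N hN _ rfl τ hτ⟩

end
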